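/- Let G be a finite simple graph with win partition α = {α_1, α_2, ..., α_k}. If w ∈ α_{k-1} ∪ α_k (that is, w lies in one of the last two intervals of the win partition of G), then for every initial configuration C_0 on G the w-power index process is eventually stable. -/

import Mathlib

open scoped Classical

/-- A strategy of a voter: collaborator (`C`) or defector (`D`). -/
inductive Strategy : Type
  | C : Strategy
  | D : Strategy
deriving DecidableEq

noncomputable section

variable {V : Type*}

/-- The closed neighbourhood `N[v]` of a vertex, as a finset. -/
def closedNbhd (G : SimpleGraph V) [Fintype V] (v : V) : Finset V :=
  Finset.univ.filter fun u => u = v ∨ G.Adj u v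

/-- The (Shapley–Shubik style) power of a vertex `v` in configuration `c`
with win condition `w`. -/
def power (G : SimpleGraph V) [Fintype V] (w : ℝ) (c : V → Strategy) (v : V) : ℝ :=
  let N := closedNbhd G v
  let nC := (N.filter fun u => c u = Strategy.C).card
  let nD := (N.filter fun u => c u = Strategy.D).card
  match c v with
  | Strategy.C => if w < (nC : ℝ) / (N.card : ℝ) then 1 / (nC : ℝ) else 0
  | Strategy.D => if (nC : ℝ) / (N.card : ℝ) ≤ w then 1 / (nD : ℝ) else 0

/-- One step of the `w`-power index process: every vertex adopts the strategy of a
vertex of maximum power in its closed neighbourhood, retaining its own strategy if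
vertices of maximum power have differing strategies. -/
def step (G : SimpleGraph V) [Fintype V] (w : ℝ) (c : V → Strategy) (v : V) : Strategy :=
  let N := closedNbhd G v
  let M := N.filter fun u => ∀ x ∈ N, power G w c x ≤ power G w c u
  if ∀ u ∈ M, c u = Strategy.C then Strategy.C
  else if ∀ u ∈ M, c u = Strategy.D then Strategy.D
  else c v

/-- `configSeq G w c0 i` is the configuration `C_i` of the `w`-power index process. -/
def configSeq (G : SimpleGraph V) [Fintype V] (w : ℝ) (c0 : V → Strategy) : ℕ → V → Strategy
  | 0 => c0
  | k + 1 => step G w (configSeq G w c0 k)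

/-- The process is eventually stable. -/
def EventuallyStable (G : SimpleGraph V) [Fintype V] (w : ℝ) (c0 : V → Strategy) : Prop :=
  ∃ i, configSeq G w c0 (i + 1) = configSeq G w c0 i

/-- The process reaches a stable all-collaborator configuration. -/
def CollaboratorDominant (G : SimpleGraph V) [Fintype V] (w : ℝ) (c0 : V → Strategy) : Prop :=
  ∃ i, configSeq G w c0 (i + 1) = configSeq G w c0 i ∧
    ∀ v, configSeq G w c0 i v = Strategy.C

/-- The process reaches a stable all-defector configuration. -/
def DefectorDominant (G : SimpleGraph V) [Fintype V] (w : ℝ) (c0 : V → Strategy) : Prop :=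
  ∃ i, configSeq G w c0 (i + 1) = configSeq G w c0 i ∧
    ∀ v, configSeq G w c0 i v = Strategy.D

/-- The process is eventually periodic with period `ℓ`: `ℓ > 1` is the least integer
such that `C_i = C_{i+ℓ}` for some `i ≥ 0`. -/
def EventuallyPeriodicWithPeriod (G : SimpleGraph V) [Fintype V] (w : ℝ)
    (c0 : V → Strategy) (ℓ : ℕ) : Prop :=
  IsLeast {m : ℕ | 1 < m ∧ ∃ i, configSeq G w c0 (i + m) = configSeq G w c0 i} ℓ

end

/-- `S_G`: the set of all possible non-zero power values in `G`, namely all numbers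
`i/|N[v]|` with `v` a vertex and `i` an integer with `|N[v]|/2 ≤ i ≤ |N[v]|`.
The win partition of `G` is the partition of `[1/2, 1)` into the intervals whose
endpoints are consecutive elements of `S_G` (together with the left endpoint `1/2`). -/
def SG {V : Type*} (G : SimpleGraph V) [Fintype V] : Set ℝ :=
  {s | ∃ (v : V) (i : ℕ), (closedNbhd G v).card ≤ 2 * i ∧ i ≤ (closedNbhd G v).card ∧
    s = (i : ℝ) / ((closedNbhd G v).card : ℝ)}

section helpers

variable {V : Type} [Fintype V] (G : SimpleGraph V) (w : ℝ)

noncomputable def numC (c : V → Strategy) (v : V) : ℕ :=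
  ((closedNbhd G v).filter fun u => c u = Strategy.C).card

noncomputable def numD (c : V → Strategy) (v : V) : ℕ :=
  ((closedNbhd G v).filter fun u => c u = Strategy.D).card

/-- Defectors that win. -/
def Perm (c : V → Strategy) (v : V) : Prop :=
  c v = Strategy.D ∧ (numC G c v : ℝ) / ((closedNbhd G v).card : ℝ) ≤ w

lemma self_mem (v : V) : v ∈ closedNbhd G v := by simp [closedNbhd]

lemma mem_symm {u v : V} (h : u ∈ closedNbhd G v) : v ∈ closedNbhd G u := by
  simp only [closedNbhd, Finset.mem_filter, Finset.mem_univ, true_and] at *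
  rcases h with h | h
  · exact Or.inl h.symm
  · exact Or.inr h.symm

lemma card_pos' (v : V) : 0 < (closedNbhd G v).card :=
  Finset.card_pos.mpr ⟨v, self_mem G v⟩

lemma num_add (c : V → Strategy) (v : V) :
    numC G c v + numD G c v = (closedNbhd G v).card := by
  unfold numC numD
  rw [← Finset.card_filter_add_card_filter_not (s := closedNbhd G v) (fun u => c u = Strategy.C)]
  congr 2
  apply Finset.filter_congr
  intro u _
  cases c u <;> simp

lemma numD_pos {c : V → Strategy} {u v : V} (h : u ∈ closedNbhd G v) (hu : c u = Strategy.D) :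
    0 < numD G c v :=
  Finset.card_pos.mpr ⟨u, by simp [h, hu]⟩

lemma numC_pos {c : V → Strategy} {u v : V} (h : u ∈ closedNbhd G v) (hu : c u = Strategy.C) :
    0 < numC G c v :=
  Finset.card_pos.mpr ⟨u, by simp [h, hu]⟩

lemma numD_two {c : V → Strategy} {x y v : V} (hxy : x ≠ y) (hx : x ∈ closedNbhd G v)
    (hy : y ∈ closedNbhd G v) (hxD : c x = Strategy.D) (hyD : c y = Strategy.D) :
    2 ≤ numD G c v :=
  Finset.one_lt_card.mpr ⟨x, by simp [hx, hxD], y, by simp [hy, hyD], hxy⟩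

lemma power_C {c : V → Strategy} {v : V} (h : c v = Strategy.C) :
    power G w c v = if w < (numC G c v : ℝ) / ((closedNbhd G v).card : ℝ)
      then 1 / (numC G c v : ℝ) else 0 := by
  simp only [power, h, numC]
  congr

lemma power_D {c : V → Strategy} {v : V} (h : c v = Strategy.D) :
    power G w c v = if (numC G c v : ℝ) / ((closedNbhd G v).card : ℝ) ≤ w
      then 1 / (numD G c v : ℝ) else 0 := by
  simp only [power, h, numC, numD]
  congr

lemma power_nonneg (c : V → Strategy) (v : V) : 0 ≤ power G w c v := by
  cases h : c v
  · rw [power_C G w h]; split_ifs <;> positivity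
  · rw [power_D G w h]; split_ifs <;> positivity

variable {G w}

lemma mem_SG (hw : 1 / 2 ≤ w) (v : V) (i : ℕ) (hi : i ≤ (closedNbhd G v).card)
    (h : w < (i : ℝ) / ((closedNbhd G v).card : ℝ)) :
    (i : ℝ) / ((closedNbhd G v).card : ℝ) ∈ SG G := by
  refine ⟨v, i, ?_, hi, rfl⟩
  have hp : (0 : ℝ) < ((closedNbhd G v).card : ℝ) := by exact_mod_cast card_pos' G v
  rw [lt_div_iff₀ hp] at h
  have : ((closedNbhd G v).card : ℝ) ≤ 2 * i := by nlinarith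
  exact_mod_cast this

lemma no_three (hlast : ∃ a b : ℝ, ∀ s ∈ SG G, w < s → s = a ∨ s = b)
    {x y z : ℝ} (hx : x ∈ SG G) (hy : y ∈ SG G) (hz : z ∈ SG G)
    (h0 : w < x) (h1 : x < y) (h2 : y < z) : False := by
  obtain ⟨a, b, hab⟩ := hlast
  rcases hab x hx h0 with h | h <;> rcases hab y hy (by linarith) with h' | h' <;>
    rcases hab z hz (by linarith) with h'' | h'' <;> linarith

/-- Two missing collaborators make the collaborators lose. -/
lemma factF (hw : 1 / 2 ≤ w ∧ w < 1)
    (hlast : ∃ a b : ℝ, ∀ s ∈ SG G, w < s → s = a ∨ s = b) (v : V) (i : ℕ)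
    (hi : i + 2 ≤ (closedNbhd G v).card) :
    (i : ℝ) / ((closedNbhd G v).card : ℝ) ≤ w := by
  by_contra hcon
  push Not at hcon
  have hp : (0 : ℝ) < ((closedNbhd G v).card : ℝ) := by exact_mod_cast card_pos' G v
  have h1 : (i : ℝ) / ((closedNbhd G v).card : ℝ)
      < ((i + 1 : ℕ) : ℝ) / ((closedNbhd G v).card : ℝ) := by
    gcongr; simp
  have h2 : ((i + 1 : ℕ) : ℝ) / ((closedNbhd G v).card : ℝ)
      < (((closedNbhd G v).card : ℕ) : ℝ) / ((closedNbhd G v).card : ℝ) := by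
    gcongr; omega
  exact no_three hlast (mem_SG hw.1 v i (by omega) hcon)
    (mem_SG hw.1 v (i + 1) (by omega) (by linarith))
    (mem_SG hw.1 v _ le_rfl (by linarith)) hcon h1 h2

lemma lemA (hw : 1 / 2 ≤ w ∧ w < 1)
    (hlast : ∃ a b : ℝ, ∀ s ∈ SG G, w < s → s = a ∨ s = b) {c : V → Strategy} {v u : V}
    (hv : Perm G w c v) (hu : u ∈ closedNbhd G v) (huC : c u = Strategy.C) :
    power G w c u ≤ power G w c v := by
  rw [power_D G w hv.1, if_pos hv.2, power_C G w huC]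
  split_ifs with h
  swap
  · positivity
  have hvu := mem_symm G hu
  have hDu := numD_pos G hvu hv.1
  have hCv := numC_pos G hu huC
  have hDv := numD_pos G (self_mem G v) hv.1
  have hsu := num_add G c u
  have hsv := num_add G c v
  have heq : numC G c u + 1 = (closedNbhd G u).card := by
    by_contra hne
    exact absurd (factF hw hlast u (numC G c u) (by omega)) (not_le.mpr h)
  have hpu : (0 : ℝ) < ((closedNbhd G u).card : ℝ) := by exact_mod_cast card_pos' G u
  have hpv : (0 : ℝ) < ((closedNbhd G v).card : ℝ) := by exact_mod_cast card_pos' G v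
  have hle : (closedNbhd G v).card ≤ (closedNbhd G u).card := by
    by_contra hlt
    push Not at hlt
    obtain ⟨k, hk⟩ : ∃ k, k + 1 = (closedNbhd G v).card := ⟨_, Nat.succ_pred_eq_of_pos (by omega)⟩
    have h1 : (numC G c u : ℝ) / ((closedNbhd G u).card : ℝ)
        < (k : ℝ) / ((closedNbhd G v).card : ℝ) := by
      rw [div_lt_div_iff₀ hpu hpv, ← hk, ← heq]
      have : ((numC G c u : ℕ) : ℝ) < k := by exact_mod_cast (by omega : numC G c u < k)
      push_cast
      nlinarith
    have h2 : (k : ℝ) / ((closedNbhd G v).card : ℝ)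
        < (((closedNbhd G v).card : ℕ) : ℝ) / ((closedNbhd G v).card : ℝ) := by
      gcongr; omega
    exact no_three hlast (mem_SG hw.1 u _ (by omega) h)
      (mem_SG hw.1 v k (by omega) (by linarith))
      (mem_SG hw.1 v _ le_rfl (by linarith)) h h1 h2
  have : (numD G c v : ℝ) ≤ numC G c u := by
    exact_mod_cast (by omega : numD G c v ≤ numC G c u)
  have h0 : (0 : ℝ) < numD G c v := by exact_mod_cast hDv
  exact one_div_le_one_div_of_le h0 this

lemma exists_max (c : V → Strategy) (v : V) :
    ∃ u ∈ closedNbhd G v, ∀ x ∈ closedNbhd G v, power G w c x ≤ power G w c u :=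
  Finset.exists_max_image _ _ ⟨v, self_mem G v⟩

lemma perm_step_D (hw : 1 / 2 ≤ w ∧ w < 1)
    (hlast : ∃ a b : ℝ, ∀ s ∈ SG G, w < s → s = a ∨ s = b) {c : V → Strategy} {v : V}
    (hv : Perm G w c v) : step G w c v = Strategy.D := by
  unfold step
  dsimp only
  rw [if_neg]
  · split_ifs
    · rfl
    · exact hv.1
  · intro hall
    obtain ⟨u, hu, hmax⟩ := exists_max (G := G) (w := w) c v
    have huC := hall u (Finset.mem_filter.mpr ⟨hu, hmax⟩)
    have hle := lemA hw hlast hv hu huC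
    have := hall v (Finset.mem_filter.mpr
      ⟨self_mem G v, fun x hx => (hmax x hx).trans hle⟩)
    rw [hv.1] at this
    cases this

lemma perm_of_two (hw : 1 / 2 ≤ w ∧ w < 1)
    (hlast : ∃ a b : ℝ, ∀ s ∈ SG G, w < s → s = a ∨ s = b) {c : V → Strategy} {x y : V}
    (hxy : x ≠ y) (hy : y ∈ closedNbhd G x) (hxD : c x = Strategy.D) (hyD : c y = Strategy.D) :
    Perm G w c x := by
  refine ⟨hxD, factF hw hlast x _ ?_⟩
  have := numD_two G hxy (self_mem G x) hy hxD hyD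
  have := num_add G c x
  omega

lemma perm_step (hw : 1 / 2 ≤ w ∧ w < 1)
    (hlast : ∃ a b : ℝ, ∀ s ∈ SG G, w < s → s = a ∨ s = b) {c : V → Strategy} {v : V}
    (hv : Perm G w c v) : Perm G w (step G w c) v := by
  have hD := perm_step_D hw hlast hv
  by_cases h : ∃ y ∈ closedNbhd G v, v ≠ y ∧ c y = Strategy.D
  · obtain ⟨y, hy, hne, hyD⟩ := h
    have hPy := perm_of_two hw hlast hne.symm (mem_symm G hy) hyD hv.1
    exact perm_of_two hw hlast hne hy hD (perm_step_D hw hlast hPy)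
  · push Not at h
    refine ⟨hD, le_trans ?_ hv.2⟩
    have : numC G (step G w c) v ≤ numC G c v := by
      apply Finset.card_le_card
      intro u hu
      rw [Finset.mem_filter] at hu ⊢
      refine ⟨hu.1, ?_⟩
      have hne : v ≠ u := by
        rintro rfl
        rw [hD] at hu
        cases hu.2
      have := h u hu.1 hne
      cases hc : c u
      · rfl
      · exact absurd hc this
    gcongr

lemma new_D_perm (hw : 1 / 2 ≤ w ∧ w < 1)
    (hlast : ∃ a b : ℝ, ∀ s ∈ SG G, w < s → s = a ∨ s = b) {c : V → Strategy} {x : V}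
    (hx : c x = Strategy.C) (hs : step G w c x = Strategy.D) : Perm G w (step G w c) x := by
  obtain ⟨y, hy, hmax⟩ := exists_max (G := G) (w := w) c x
  have hall : ∀ u ∈ (closedNbhd G x).filter
      (fun u => ∀ z ∈ closedNbhd G x, power G w c z ≤ power G w c u), c u = Strategy.D := by
    have hs' := hs
    unfold step at hs'
    dsimp only at hs'
    split_ifs at hs' with h1 h2
    · exact h2
    · rw [hx] at hs'; cases hs'
  have hyD := hall y (Finset.mem_filter.mpr ⟨hy, hmax⟩)
  have hpos : 0 < power G w c y := by
    by_contra hn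
    have hx0 : power G w c y ≤ power G w c x := by
      have := power_nonneg G w c x
      linarith
    have := hall x (Finset.mem_filter.mpr
      ⟨self_mem G x, fun z hz => (hmax z hz).trans hx0⟩)
    rw [hx] at this
    cases this
  have hPy : Perm G w c y := by
    refine ⟨hyD, ?_⟩
    rw [power_D G w hyD] at hpos
    split_ifs at hpos with h
    · exact h
    · exact absurd hpos (lt_irrefl _)
  have hne : x ≠ y := by
    rintro rfl
    rw [hx] at hyD
    cases hyD
  exact perm_of_two hw hlast hne hy hs (perm_step_D hw hlast hPy)

variable (G w)

noncomputable def permSet (c : V → Strategy) : Finset V := Finset.univ.filter (Perm G w c)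

noncomputable def defSet (c : V → Strategy) : Finset V :=
  Finset.univ.filter fun v => c v = Strategy.D

noncomputable def measureFn (c : V → Strategy) : ℕ :=
  (Fintype.card V + 1) * (Fintype.card V - (permSet G w c).card) + (defSet c).card

variable {G w}

lemma measure_lt (hw : 1 / 2 ≤ w ∧ w < 1)
    (hlast : ∃ a b : ℝ, ∀ s ∈ SG G, w < s → s = a ∨ s = b) {c : V → Strategy}
    (hne : step G w c ≠ c) : measureFn G w (step G w c) < measureFn G w c := by
  have hsub : permSet G w c ⊆ permSet G w (step G w c) := by
    intro v hv
    simp only [permSet, Finset.mem_filter, Finset.mem_univ, true_and] at *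
    exact perm_step hw hlast hv
  unfold measureFn
  rcases hsub.eq_or_ssubset with heq | hss
  · rw [← heq]
    apply Nat.add_lt_add_left
    have hsd : defSet (step G w c) ⊆ defSet c := by
      intro v hv
      simp only [defSet, Finset.mem_filter, Finset.mem_univ, true_and] at *
      cases hc : c v
      · have h1 : v ∈ permSet G w (step G w c) := by
          simp only [permSet, Finset.mem_filter, Finset.mem_univ, true_and]
          exact new_D_perm hw hlast hc hv
        rw [← heq] at h1
        simp only [permSet, Finset.mem_filter, Finset.mem_univ, true_and] at h1
        exact hc.symm.trans h1.1
      · rfl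
    apply Finset.card_lt_card
    refine hsd.ssubset_of_ne fun he => hne ?_
    funext v
    have := Finset.ext_iff.mp he v
    simp only [defSet, Finset.mem_filter, Finset.mem_univ, true_and] at this
    cases h1 : step G w c v <;> cases h2 : c v <;> simp_all
  · have h1 := Finset.card_lt_card hss
    have h2 : (permSet G w (step G w c)).card ≤ Fintype.card V := Finset.card_le_univ _
    have h3 : (defSet (step G w c)).card ≤ Fintype.card V := Finset.card_le_univ _
    obtain ⟨a, ha⟩ := Nat.exists_eq_add_of_le h2
    obtain ⟨b, hb⟩ := Nat.exists_eq_add_of_lt h1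
    have e1 : Fintype.card V - (permSet G w (step G w c)).card = a := by omega
    have e2 : Fintype.card V - (permSet G w c).card = a + b + 1 := by omega
    rw [e1, e2]
    nlinarith [Nat.zero_le b, Nat.zero_le (Fintype.card V * b)]

end helpers

/-- If `w ∈ [1/2, 1)` lies in one of the last two intervals of the
win partition of `G` (equivalently, at most two elements of `S_G` exceed `w`), then
every initial configuration on `G` is eventually stable in the `w`-power index
process. -/
theorem statement5 {V : Type} [Fintype V] (G : SimpleGraph V) (w : ℝ)
    (hw : 1 / 2 ≤ w ∧ w < 1)
    (hlast : ∃ a b : ℝ, ∀ s ∈ SG G, w < s → s = a ∨ s = b)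
    (c0 : V → Strategy) :
    EventuallyStable G w c0 := by
  by_contra hcon
  unfold EventuallyStable at hcon
  push Not at hcon
  have hdec : ∀ i, measureFn G w (configSeq G w c0 (i + 1)) < measureFn G w (configSeq G w c0 i) :=
    fun i => measure_lt hw hlast (hcon i)
  have hb : ∀ i, measureFn G w (configSeq G w c0 i) + i ≤ measureFn G w (configSeq G w c0 0) := by
    intro i
    induction i with
    | zero => simp
    | succ k ih => have := hdec k; omega
  have := hb (measureFn G w (configSeq G w c0 0) + 1)
  omega
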